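/- Fix an integer n ≥ 1, τ ∈ ℂ with Im τ > 0, and μ, κ ∈ ℂ. For a subset I ⊆ {1, …, n} let e_I ∈ ℂⁿ denote its indicator vector, and for r ∈ {1, …, n} define the elliptic Ruijsenaars (Macdonald-type) difference operator D_r acting on functions f : ℂⁿ → ℂ by (D_r f)(x) := Σ_{I ⊆ {1,…,n}, |I| = r} ( Π_{i ∈ I, j ∉ I} ϑ1(x_i − x_j − μ | τ) / ϑ1(x_i − x_j | τ) ) · f(x + κ e_I), defined at points where the occurring denominators are nonzero. Then the operators commute: for all r, s ∈ {1, …, n}, every function f : ℂⁿ → ℂ, and every x ∈ ℂⁿ such that x_i − x_j + c ∉ ℤ + τℤ for all i ≠ j and all c ∈ {−κ, 0, κ}, one has (D_r (D_s f))(x) = (D_s (D_r f))(x). -/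

import Mathlib

open Complex

/-- The Jacobi theta function
`ϑ₁(z|τ) = −i Σ_{n∈ℤ} (−1)^n exp(πiτ(n+1/2)² + (2n+1)πiz)`. -/
noncomputable def jacobiTheta1 (z τ : ℂ) : ℂ :=
  -I * ∑' n : ℤ, (-1 : ℂ) ^ n *
    Complex.exp ((Real.pi : ℂ) * I * τ * ((n : ℂ) + 1 / 2) ^ 2 +
      (2 * (n : ℂ) + 1) * (Real.pi : ℂ) * I * z)

/-- The Jacobi theta function `ϑ₄(z|τ) = Σ_{n∈ℤ} (−1)^n exp(πiτn² + 2πinz)`. -/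
noncomputable def jacobiTheta4 (z τ : ℂ) : ℂ :=
  ∑' n : ℤ, (-1 : ℂ) ^ n *
    Complex.exp ((Real.pi : ℂ) * I * τ * (n : ℂ) ^ 2 + 2 * (Real.pi : ℂ) * I * (n : ℂ) * z)

/-- The lattice `ℤ + τℤ ⊂ ℂ`. -/
def latticeZtau (τ : ℂ) : Set ℂ := {u | ∃ m n : ℤ, u = (m : ℂ) + (n : ℂ) * τ}

/-- The elliptic Ruijsenaars (Macdonald-type) difference operator
`(D_r f)(x) = Σ_{|I| = r} (Π_{i ∈ I, j ∉ I} ϑ₁(x_i−x_j−μ|τ)/ϑ₁(x_i−x_j|τ)) f(x + κ e_I)`,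
the sum being over the `r`-element subsets `I` of `{1, …, n}` and `e_I` denoting the
indicator vector of `I`. -/
noncomputable def ruijsenaarsD (n r : ℕ) (μ κ τ : ℂ) (f : (Fin n → ℂ) → ℂ) :
    (Fin n → ℂ) → ℂ :=
  fun x => ∑ I ∈ Finset.powersetCard r (Finset.univ : Finset (Fin n)),
    (∏ i ∈ I, ∏ j ∈ Iᶜ, jacobiTheta1 (x i - x j - μ) τ / jacobiTheta1 (x i - x j) τ) *
      f (fun j => x j + if j ∈ I then κ else 0)


open Filter Topology

structure IsSig (τ : ℂ) (σ : ℂ → ℂ) : Prop where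
  diff : Differentiable ℂ σ
  odd : ∀ z, σ (-z) = -σ z
  per1 : ∀ z, σ (z + 1) = -σ z
  pert : ∀ z, σ (z + τ) = -(Complex.exp (-(Real.pi * I * τ) - 2 * Real.pi * I * z)) * σ z
  zero : ∀ z, σ z = 0 ↔ z ∈ latticeZtau τ
  der : deriv σ 0 ≠ 0

noncomputable def eE (q u : ℂ) : ℂ := ∏' n : ℕ, (1 + (-(q ^ (n + 1) * u)))

theorem eE_summable {q : ℂ} (hq : ‖q‖ < 1) (u : ℂ) :
    Summable (fun n : ℕ => ‖-(q ^ (n + 1) * u)‖) := by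
  have h := ((summable_nat_add_iff 1).mpr (summable_geometric_of_lt_one (norm_nonneg _) hq)).mul_right ‖u‖
  simpa using h

theorem eE_step {q : ℂ} (hq : ‖q‖ < 1) (u : ℂ) : eE q u = (1 - q * u) * eE q (q * u) := by
  have hm : Multipliable (fun n : ℕ => 1 + (-(q ^ (n + 1) * (q * u)))) :=
    multipliable_one_add_of_summable (eE_summable hq (q * u))
  unfold eE
  rw [tprod_eq_zero_mul']
  · congr 1
    · ring
    · refine tprod_congr fun n => ?_
      ring
  · refine hm.congr fun n => ?_
    ring

theorem eE_ne_zero {q : ℂ} (hq : ‖q‖ < 1) (u : ℂ) (h : ∀ n : ℕ, q ^ (n + 1) * u ≠ 1) :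
    eE q u ≠ 0 := by
  refine tprod_one_add_ne_zero_of_summable (fun n hn => h n ?_) (eE_summable hq u)
  linear_combination -hn

theorem eE_diff {q : ℂ} (hq : ‖q‖ < 1) : Differentiable ℂ (eE q) := by
  intro u
  have hb : IsOpen (Metric.ball (0 : ℂ) (‖u‖ + 1)) := Metric.isOpen_ball
  have hs := ((summable_nat_add_iff 1).mpr
    (summable_geometric_of_lt_one (norm_nonneg _) hq)).mul_right (‖u‖ + 1)
  have h := Summable.hasProdLocallyUniformlyOn_nat_one_add (f := fun n (u : ℂ) => -(q ^ (n + 1) * u))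
    hb hs (Eventually.of_forall fun n x hx => by
      have : ‖x‖ < ‖u‖ + 1 := by simpa using hx
      simp only [norm_neg, norm_mul, norm_pow]
      gcongr) (fun n => by fun_prop)
  have h2 : DifferentiableOn ℂ (eE q) (Metric.ball (0 : ℂ) (‖u‖ + 1)) :=
    TendstoLocallyUniformlyOn.differentiableOn
      (hasProdLocallyUniformlyOn_iff_tendstoLocallyUniformlyOn.mp h)
      (.of_forall fun _ ↦ DifferentiableOn.fun_finsetProd (fun _ _ ↦ by fun_prop)) hb
  exact h2.differentiableAt (hb.mem_nhds (by simp))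

noncomputable def sg (τ z : ℂ) : ℂ :=
  Complex.exp (-(Real.pi * I * z)) * (1 - Complex.exp (2 * Real.pi * I * z)) *
    eE (Complex.exp (2 * Real.pi * I * τ)) (Complex.exp (2 * Real.pi * I * z)) *
    eE (Complex.exp (2 * Real.pi * I * τ)) (Complex.exp (-(2 * Real.pi * I * z)))

theorem norm_q_lt {τ : ℂ} (hτ : 0 < τ.im) : ‖Complex.exp (2 * Real.pi * I * τ)‖ < 1 := by
  rw [Complex.norm_exp]
  simp
  positivity

theorem exp_pi_I' : Complex.exp (-(Real.pi * I)) = -1 := by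
  rw [Complex.exp_neg, Complex.exp_pi_mul_I]; norm_num

theorem sg_isSig {τ : ℂ} (hτ : 0 < τ.im) : IsSig τ (sg τ) := by
  have hq := norm_q_lt hτ
  have hdE := eE_diff hq
  have hodd : ∀ z, sg τ (-z) = -sg τ z := by
    intro z
    unfold sg
    have e1 : Complex.exp (-(Real.pi * I * -z)) =
      Complex.exp (-(Real.pi * I * z)) * Complex.exp (2 * Real.pi * I * z) := by
      rw [← Complex.exp_add]; ring_nf
    have e2 : Complex.exp (2 * Real.pi * I * z) * Complex.exp (2 * Real.pi * I * -z) = 1 := by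
      rw [← Complex.exp_add]; ring_nf; simp
    have e3 : Complex.exp (-(2 * Real.pi * I * -z)) = Complex.exp (2 * Real.pi * I * z) := by ring_nf
    have e4 : Complex.exp (-(2 * Real.pi * I * z)) = Complex.exp (2 * Real.pi * I * -z) := by ring_nf
    rw [e1, e3, e4]
    linear_combination (-(Complex.exp (-(Real.pi * I * z))) * eE (Complex.exp (2 * Real.pi * I * τ)) (Complex.exp (2 * Real.pi * I * z)) *
      eE (Complex.exp (2 * Real.pi * I * τ)) (Complex.exp (2 * Real.pi * I * -z))) * e2
  have hper1 : ∀ z, sg τ (z + 1) = -sg τ z := by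
    intro z
    unfold sg
    have e1 : Complex.exp (2 * Real.pi * I * (z + 1)) = Complex.exp (2 * Real.pi * I * z) := by
      rw [mul_add, Complex.exp_add, mul_one, Complex.exp_two_pi_mul_I, mul_one]
    have e2 : Complex.exp (-(2 * Real.pi * I * (z + 1))) = Complex.exp (-(2 * Real.pi * I * z)) := by
      rw [Complex.exp_neg, e1, Complex.exp_neg]
    have e3 : Complex.exp (-(Real.pi * I * (z + 1))) = -Complex.exp (-(Real.pi * I * z)) := by
      rw [mul_add, neg_add, Complex.exp_add, mul_one, exp_pi_I']; ring
    rw [e1, e2, e3]; ring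
  have hpert : ∀ z, sg τ (z + τ) = -(Complex.exp (-(Real.pi * I * τ) - 2 * Real.pi * I * z)) * sg τ z := by
    intro z
    unfold sg
    set q := Complex.exp (2 * Real.pi * I * τ) with hqd
    set w := Complex.exp (2 * Real.pi * I * z) with hw
    have hw0 : w ≠ 0 := Complex.exp_ne_zero _
    have hq0 : q ≠ 0 := Complex.exp_ne_zero _
    have e1 : Complex.exp (2 * Real.pi * I * (z + τ)) = q * w := by
      rw [mul_add, Complex.exp_add, mul_comm]
    have e2 : Complex.exp (-(2 * Real.pi * I * (z + τ))) = (q * w)⁻¹ := by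
      rw [Complex.exp_neg, e1]
    have e3 : Complex.exp (-(2 * Real.pi * I * z)) = w⁻¹ := by
      rw [Complex.exp_neg]
    have e4 : Complex.exp (-(Real.pi * I * (z + τ))) =
        Complex.exp (-(Real.pi * I * τ)) * Complex.exp (-(Real.pi * I * z)) := by
      rw [← Complex.exp_add]; ring_nf
    have e5 : Complex.exp (-(Real.pi * I * τ) - 2 * Real.pi * I * z) =
        Complex.exp (-(Real.pi * I * τ)) * w⁻¹ := by
      rw [sub_eq_add_neg, Complex.exp_add, e3]
    rw [e1, e2, e3, e4, e5, eE_step hq w, eE_step hq (q * w)⁻¹]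
    have e6 : q * (q * w)⁻¹ = w⁻¹ := by field_simp
    rw [e6]
    field_simp
    ring
  have hdiff : Differentiable ℂ (sg τ) := by
    unfold sg
    have h1 : Differentiable ℂ (fun z : ℂ => eE (Complex.exp (2 * Real.pi * I * τ)) (Complex.exp (2 * Real.pi * I * z))) :=
      hdE.comp (by fun_prop)
    have h2 : Differentiable ℂ (fun z : ℂ => eE (Complex.exp (2 * Real.pi * I * τ)) (Complex.exp (-(2 * Real.pi * I * z)))) :=
      hdE.comp (by fun_prop)
    fun_prop
  have h0 : sg τ 0 = 0 := by simp [sg]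
  have hexp : ∀ (m : ℤ) (z : ℂ), Complex.exp (2 * Real.pi * I * (z + m * τ)) = 1 → z ∈ latticeZtau τ := by
    intro m z h
    rw [Complex.exp_eq_one_iff] at h
    obtain ⟨k, hk⟩ := h
    have hpi : (2 * Real.pi * I : ℂ) ≠ 0 := Complex.two_pi_I_ne_zero
    refine ⟨k, -m, ?_⟩
    have : (2 * Real.pi * I : ℂ) * (z + m * τ) = (2 * Real.pi * I : ℂ) * k := by rw [hk]; ring
    have := mul_left_cancel₀ hpi this
    push_cast
    linear_combination this
  have hE1 : eE (Complex.exp (2 * Real.pi * I * τ)) 1 ≠ 0 := by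
    refine eE_ne_zero hq 1 fun n hn => ?_
    rw [mul_one] at hn
    have : ‖Complex.exp (2 * Real.pi * I * τ)‖ ^ (n + 1) < 1 := pow_lt_one₀ (norm_nonneg _) hq (by simp)
    rw [← norm_pow, hn] at this
    simp at this
  refine ⟨hdiff, hodd, hper1, hpert, ?_, ?_⟩
  · intro z
    constructor
    · intro h
      unfold sg at h
      by_contra hz
      have a1 : 1 - Complex.exp (2 * Real.pi * I * z) ≠ 0 := by
        intro h1
        exact hz (hexp 0 z (by simp; linear_combination -h1))
      have a2 : eE (Complex.exp (2 * Real.pi * I * τ)) (Complex.exp (2 * Real.pi * I * z)) ≠ 0 := by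
        refine eE_ne_zero hq _ fun n hn => hz (hexp (n + 1) z ?_)
        rw [← hn, ← Complex.exp_nat_mul, ← Complex.exp_add]
        congr 1; push_cast; ring
      have a3 : eE (Complex.exp (2 * Real.pi * I * τ)) (Complex.exp (-(2 * Real.pi * I * z))) ≠ 0 := by
        refine eE_ne_zero hq _ fun n hn => hz (hexp (-(n + 1)) z ?_)
        have : Complex.exp (2 * Real.pi * I * (z + (-(n + 1) : ℤ) * τ)) =
          (Complex.exp (2 * Real.pi * I * τ) ^ (n + 1) * Complex.exp (-(2 * Real.pi * I * z)))⁻¹ := by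
          rw [← Complex.exp_nat_mul, ← Complex.exp_add, ← Complex.exp_neg]
          congr 1; push_cast; ring
        rw [this, hn, inv_one]
      exact (mul_ne_zero (mul_ne_zero (mul_ne_zero (Complex.exp_ne_zero _) a1) a2) a3) h
    · have key1 : ∀ z, sg τ (z + 1) = 0 ↔ sg τ z = 0 := fun z => by rw [hper1]; simp
      have key2 : ∀ z, sg τ (z + τ) = 0 ↔ sg τ z = 0 := fun z => by
        rw [hpert]; simp [Complex.exp_ne_zero]
      have hm : ∀ (m : ℤ), sg τ m = 0 := by
        intro m
        induction m using Int.induction_on with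
        | zero => simpa using h0
        | succ k ih => push_cast at ih ⊢; rwa [key1]
        | pred k ih =>
          rw [← key1]; push_cast at ih ⊢; rwa [sub_add_cancel]
      rintro ⟨m, n, rfl⟩
      induction n using Int.induction_on with
      | zero => simpa using hm m
      | succ k ih =>
        push_cast at ih ⊢
        rw [show (m : ℂ) + (k + 1) * τ = (m + k * τ) + τ by ring]; rwa [key2]
      | pred k ih =>
        push_cast at ih ⊢
        rw [← key2]
        rw [show (m : ℂ) + (-k - 1) * τ + τ = (m + -k * τ) by ring]; assumption
  · have hd : HasDerivAt (fun z : ℂ => 1 - Complex.exp (2 * Real.pi * I * z)) (-(2 * Real.pi * I)) 0 := by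
      have := (((hasDerivAt_id (0 : ℂ)).const_mul (2 * Real.pi * I : ℂ)).cexp).const_sub 1
      simpa using this
    let G : ℂ → ℂ := fun z => Complex.exp (-(Real.pi * I * z)) *
      eE (Complex.exp (2 * Real.pi * I * τ)) (Complex.exp (2 * Real.pi * I * z)) *
      eE (Complex.exp (2 * Real.pi * I * τ)) (Complex.exp (-(2 * Real.pi * I * z)))
    have hG : Differentiable ℂ G := by
      have h1 : Differentiable ℂ (fun z : ℂ => eE (Complex.exp (2 * Real.pi * I * τ)) (Complex.exp (2 * Real.pi * I * z))) :=
        hdE.comp (by fun_prop)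
      have h2 : Differentiable ℂ (fun z : ℂ => eE (Complex.exp (2 * Real.pi * I * τ)) (Complex.exp (-(2 * Real.pi * I * z)))) :=
        hdE.comp (by fun_prop)
      fun_prop
    have hmul := hd.mul (hG 0).hasDerivAt
    have heq : sg τ = (fun z : ℂ => 1 - Complex.exp (2 * Real.pi * I * z)) * G := by
      funext z; simp only [sg, G, Pi.mul_apply]; ring
    rw [heq, hmul.deriv]
    simp [G, hE1]

theorem liou {τ : ℂ} (hτ : 0 < τ.im) (g : ℂ → ℂ) (C : ℂ) (hC : C ≠ 0) (hg : Differentiable ℂ g)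
    (h1 : ∀ z, g (z + 1) = g z) (ht : ∀ z, g (z + τ) = C * g z) :
    ∃ A : ℂ, ∀ z, g z = A * Complex.exp (-(I * ((Real.log ‖C‖ / τ.im : ℝ) : ℂ) * z)) := by
  set β : ℝ := Real.log ‖C‖ / τ.im with hβ
  let G : ℂ → ℂ := fun z => Complex.exp (I * β * z) * g z
  have hG : Differentiable ℂ G := by fun_prop
  have n1 : ∀ z, ‖G (z + 1)‖ = ‖G z‖ := by
    intro z
    simp only [G, norm_mul, h1, Complex.norm_exp]
    simp
  have nt : ∀ z, ‖G (z + τ)‖ = ‖G z‖ := by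
    intro z
    simp only [G, norm_mul, ht, Complex.norm_exp]
    have hCe : ‖C‖ = Real.exp (β * τ.im) := by
      rw [hβ, div_mul_cancel₀ _ hτ.ne', Real.exp_log (norm_pos_iff.mpr hC)]
    rw [hCe, ← mul_assoc, ← Real.exp_add]
    congr 2
    simp
    ring
  have nm : ∀ (m : ℤ) z, ‖G (z + m)‖ = ‖G z‖ := by
    intro m z
    induction m using Int.induction_on with
    | zero => simp
    | succ k ih => rw [← ih, ← n1 (z + ((k : ℤ) : ℂ))]; push_cast; ring_nf
    | pred k ih => rw [← ih, ← n1]; push_cast; ring_nf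
  have nn : ∀ (m : ℤ) z, ‖G (z + m * τ)‖ = ‖G z‖ := by
    intro m z
    induction m using Int.induction_on with
    | zero => simp
    | succ k ih => rw [← ih, ← nt (z + ((k : ℤ) : ℂ) * τ)]; push_cast; ring_nf
    | pred k ih => rw [← ih, ← nt]; push_cast; ring_nf
  obtain ⟨B, hB⟩ := (isCompact_closedBall (0 : ℂ) (1 + τ.im)).exists_bound_of_continuousOn
    hG.continuous.continuousOn
  have hbd : ∀ z, ‖G z‖ ≤ B := by
    intro z
    set n : ℤ := ⌊z.im / τ.im⌋ with hn
    set m : ℤ := ⌊(z - n * τ).re⌋ with hm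
    have e : G z = G ((z - n * τ - m) + m + n * τ) := by congr 1; ring
    rw [e, nn, nm]
    apply hB
    rw [mem_closedBall_zero_iff]
    have a1 := Int.floor_le (z.im / τ.im)
    have a2 := Int.lt_floor_add_one (z.im / τ.im)
    have a3 := Int.floor_le (z - n * τ).re
    have a4 := Int.lt_floor_add_one (z - n * τ).re
    rw [← hn] at a1 a2
    rw [← hm] at a3 a4
    rw [le_div_iff₀ hτ] at a1
    rw [div_lt_iff₀ hτ] at a2
    refine (Complex.norm_le_abs_re_add_abs_im _).trans ?_
    have r : (z - n * τ - m).re = (z - n * τ).re - m := by simp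
    have i : (z - n * τ - m).im = z.im - n * τ.im := by simp
    rw [r, i]
    refine add_le_add ?_ ?_
    · rw [abs_le]; constructor <;> linarith
    · rw [abs_le]; constructor <;> linarith
  have hcon : ∀ z, G z = G 0 := fun z => by
    apply hG.apply_eq_apply_of_bounded
    rw [isBounded_iff_forall_norm_le]
    exact ⟨B, by rintro _ ⟨y, rfl⟩; exact hbd y⟩
  refine ⟨G 0, fun z => ?_⟩
  rw [← hcon z]
  simp only [G]
  rw [mul_right_comm, ← Complex.exp_add]
  simp

theorem IsSig.ev_ne {τ : ℂ} {σ : ℂ → ℂ} (hσ : IsSig τ σ) (a z : ℂ) :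
    ∀ᶠ w in 𝓝[≠] z, σ (w - a) ≠ 0 := by
  have hd : Differentiable ℂ (fun w => σ (w - a)) := hσ.diff.comp (by fun_prop)
  have han : AnalyticOnNhd ℂ (fun w => σ (w - a)) Set.univ := fun w _ =>
    hd.analyticAt w
  rcases (han z trivial).eventually_eq_zero_or_eventually_ne_zero with h | h
  · exfalso
    have h2 := han.eqOn_zero_of_preconnected_of_eventuallyEq_zero isPreconnected_univ trivial h
    have : σ = fun _ => 0 := by
      funext w
      simpa using h2 (Set.mem_univ (w + a))
    apply hσ.der
    rw [this]; simp
  · exact h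

theorem ext_lemma {τ : ℂ} (hτ : 0 < τ.im) {σ : ℂ → ℂ} (hσ : IsSig τ σ) (S : Finset ℂ) (φ : ℂ → ℂ)
    (C : ℂ) (hC : C ≠ 0) (h1 : ∀ z, φ (z + 1) = φ z) (ht : ∀ z, φ (z + τ) = C * φ z)
    (hd : ∀ z, (∀ a ∈ S, σ (z - a) ≠ 0) → DifferentiableAt ℂ φ z)
    (hl : ∀ a ∈ S, Tendsto (fun z => (z - a) * φ z) (𝓝[≠] a) (𝓝 0)) :
    ∃ A : ℂ, ∀ z, (∀ a ∈ S, σ (z - a) ≠ 0) →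
      φ z = A * Complex.exp (-(I * ((Real.log ‖C‖ / τ.im : ℝ) : ℂ) * z)) := by
  have hev : ∀ z, ∀ᶠ w in 𝓝[≠] z, ∀ a ∈ S, σ (w - a) ≠ 0 := by
    intro z
    rw [Filter.eventually_all_finset]
    exact fun a _ => hσ.ev_ne a z
  have tr : ∀ a b : ℂ, Tendsto (fun z => z - b) (𝓝[≠] (a + b)) (𝓝[≠] a) := by
    intro a b
    refine tendsto_nhdsWithin_of_tendsto_nhds_of_eventually_within _ ?_ ?_
    · have : Tendsto (fun z : ℂ => z - b) (𝓝 (a + b)) (𝓝 (a + b - b)) :=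
        (continuous_sub_right b).tendsto _
      rw [add_sub_cancel_right] at this
      exact this.mono_left nhdsWithin_le_nhds
    · filter_upwards [self_mem_nhdsWithin] with z hz
      simp only [Set.mem_compl_iff, Set.mem_singleton_iff] at hz ⊢
      exact fun h => hz (by rw [← h]; ring)
  -- limits at all translates
  have hT : ∀ a, Tendsto (fun z => (z - a) * φ z) (𝓝[≠] a) (𝓝 0) ↔
      Tendsto (fun z => (z - (a + 1)) * φ z) (𝓝[≠] (a + 1)) (𝓝 0) := by
    intro a
    constructor
    · intro h
      refine (h.comp (tr a 1)).congr fun z => ?_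
      simp only [Function.comp]
      rw [← h1 (z - 1)]; ring_nf
    · intro h
      have := (h.comp ((by simpa using tr (a + 1) (-1) : Tendsto (fun z => z + 1) (𝓝[≠] a) (𝓝[≠] (a + 1)))))
      refine this.congr fun z => ?_
      simp only [Function.comp]
      rw [h1 z]; ring_nf
  have hTt : ∀ a, Tendsto (fun z => (z - a) * φ z) (𝓝[≠] a) (𝓝 0) ↔
      Tendsto (fun z => (z - (a + τ)) * φ z) (𝓝[≠] (a + τ)) (𝓝 0) := by
    intro a
    constructor
    · intro h
      have := (h.comp (tr a τ)).const_mul C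
      rw [mul_zero] at this
      refine this.congr fun z => ?_
      simp only [Function.comp]
      have := ht (z - τ)
      rw [sub_add_cancel] at this
      rw [this]; ring
    · intro h
      have := (h.comp ((by simpa using tr (a + τ) (-τ) : Tendsto (fun z => z + τ) (𝓝[≠] a) (𝓝[≠] (a + τ))))).const_mul C⁻¹
      rw [mul_zero] at this
      refine this.congr fun z => ?_
      simp only [Function.comp]
      rw [ht z]; field_simp; ring
  have hTm : ∀ (m : ℤ) a, Tendsto (fun z => (z - a) * φ z) (𝓝[≠] a) (𝓝 0) ↔
      Tendsto (fun z => (z - (a + m)) * φ z) (𝓝[≠] (a + m)) (𝓝 0) := by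
    intro m a
    induction m using Int.induction_on with
    | zero => simp
    | succ k ih => rw [ih, hT]; push_cast; simp only [add_assoc]
    | pred k ih =>
      rw [ih, hT (a + ((-k - 1 : ℤ) : ℂ))]; push_cast
      rw [show a + (-(k : ℂ) - 1) + 1 = a + -k by ring]
  have hTn : ∀ (m : ℤ) a, Tendsto (fun z => (z - a) * φ z) (𝓝[≠] a) (𝓝 0) ↔
      Tendsto (fun z => (z - (a + m * τ)) * φ z) (𝓝[≠] (a + m * τ)) (𝓝 0) := by
    intro m a
    induction m using Int.induction_on with
    | zero => simp
    | succ k ih =>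
      rw [ih, hTt]; push_cast
      rw [show a + (k : ℂ) * τ + τ = a + (k + 1) * τ by ring]
    | pred k ih =>
      rw [ih, hTt (a + ((-k - 1 : ℤ) : ℂ) * τ)]; push_cast
      rw [show a + (-(k : ℂ) - 1) * τ + τ = a + -k * τ by ring]
  have hlim : ∀ b, Tendsto (fun z => (z - b) * φ z) (𝓝[≠] b) (𝓝 0) := by
    intro b
    by_cases hb : ∀ a ∈ S, σ (b - a) ≠ 0
    · have hc := (hd b hb).continuousAt
      have : ContinuousAt (fun z => (z - b) * φ z) b := by fun_prop
      have := this.tendsto.mono_left (nhdsWithin_le_nhds (s := {b}ᶜ))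
      simpa using this
    · push Not at hb
      obtain ⟨a, ha, hz⟩ := hb
      obtain ⟨m, n, hmn⟩ := (hσ.zero _).mp hz
      have := (hTn n _).mp ((hTm m a).mp (hl a ha))
      rwa [show a + m + n * τ = b by linear_combination -hmn] at this
  let g : ℂ → ℂ := fun z => limUnder (𝓝[≠] z) φ
  have hgφ : ∀ z, (∀ a ∈ S, σ (z - a) ≠ 0) → g z = φ z := fun z hz =>
    ((hd z hz).continuousAt.tendsto.mono_left nhdsWithin_le_nhds).limUnder_eq
  have hg : Differentiable ℂ g := by
    intro z
    have ho : (fun w => φ w - φ z) =o[𝓝[≠] z] fun w => (w - z)⁻¹ := by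
      rw [Asymptotics.isLittleO_iff_tendsto']
      · have e1 : Tendsto (fun w => (w - z) * φ z) (𝓝[≠] z) (𝓝 0) := by
          have : ContinuousAt (fun w => (w - z) * φ z) z := by fun_prop
          have := this.tendsto.mono_left (nhdsWithin_le_nhds (s := {z}ᶜ))
          simpa using this
        have := (hlim z).sub e1
        rw [sub_zero] at this
        refine this.congr fun w => ?_
        rw [div_inv_eq_mul]; ring
      · filter_upwards [self_mem_nhdsWithin] with w hw h0
        exact absurd (inv_eq_zero.mp h0) (sub_ne_zero.mpr hw)
    have hs : {w | ∀ a ∈ S, σ (w - a) ≠ 0} ∈ 𝓝[≠] z := hev z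
    have hu := differentiableOn_update_limUnder_insert_of_isLittleO hs
      (fun w hw => (hd w hw).differentiableWithinAt) ho
    have hn : insert z {w | ∀ a ∈ S, σ (w - a) ≠ 0} ∈ 𝓝 z := insert_mem_nhds_iff.2 hs
    refine (hu.differentiableAt hn).congr_of_eventuallyEq ?_
    filter_upwards [hn] with w hw
    by_cases hwz : w = z
    · subst hwz; simp [g]
    · rw [Function.update_of_ne hwz]
      exact hgφ w (hw.resolve_left hwz)
  have hge : ∀ (b D : ℂ), (∀ z, φ (z + b) = D * φ z) → ∀ z, g (z + b) = D * g z := by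
    intro b D hb z
    have c1 : Tendsto (fun w => g (w + b)) (𝓝[≠] z) (𝓝 (g (z + b))) :=
      ((hg.continuous.comp (continuous_add_const b)).tendsto z).mono_left nhdsWithin_le_nhds
    have c2 : Tendsto (fun w => D * g w) (𝓝[≠] z) (𝓝 (D * g z)) :=
      ((continuous_const.mul hg.continuous).tendsto z).mono_left nhdsWithin_le_nhds
    refine tendsto_nhds_unique (c1.congr' ?_) c2
    have hb' : Tendsto (fun w => w + b) (𝓝[≠] z) (𝓝[≠] (z + b)) := by
      simpa using tr (z + b) (-b)
    filter_upwards [hev z, hb'.eventually (hev (z + b))] with w hw hw2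
    rw [hgφ _ hw, hgφ _ hw2, hb]
  obtain ⟨A, hA⟩ := liou hτ g C hC hg (fun z => by simpa using hge 1 1 (by simpa using h1) z) (hge τ C ht)
  exact ⟨A, fun z hz => by rw [← hgφ z hz, hA]⟩

theorem theta1_eq (z τ : ℂ) : jacobiTheta1 z τ =
    -I * Complex.exp (Real.pi * I * τ / 4 + Real.pi * I * z) *
      jacobiTheta₂ (z + 1 / 2 + τ / 2) τ := by
  unfold jacobiTheta1 jacobiTheta₂
  rw [← tsum_mul_left, ← tsum_mul_left]
  refine tsum_congr fun n => ?_
  have h : (-1 : ℂ) ^ n = Complex.exp (n * (Real.pi * I)) := by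
    rw [Complex.exp_int_mul, Complex.exp_pi_mul_I]
  rw [h, jacobiTheta₂_term, mul_assoc (-I) (Complex.exp _), ← Complex.exp_add, ← Complex.exp_add]
  congr 2
  ring

theorem IsSig.slope {τ : ℂ} {σ : ℂ → ℂ} (hσ : IsSig τ σ) (a : ℂ) :
    Tendsto (fun z => (z - a) / σ (z - a)) (𝓝[≠] a) (𝓝 (deriv σ 0)⁻¹) := by
  have h0 : σ 0 = 0 := by
    have := hσ.odd 0
    rw [neg_zero] at this
    linear_combination this / 2
  have h := (hσ.diff 0).hasDerivAt
  have h' : HasDerivAt (fun z => σ (z - a)) (deriv σ 0) a := by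
    have := HasDerivAt.comp_sub_const (f := σ) (f' := deriv σ 0) a a (by simpa using h)
    exact this
  have hs := (hasDerivAt_iff_tendsto_slope.mp h').inv₀ hσ.der
  refine hs.congr fun z => ?_
  simp [slope_def_field, h0]

theorem theta1_sig {τ : ℂ} (hτ : 0 < τ.im) {σ : ℂ → ℂ} (hσ : IsSig τ σ) :
    ∃ c : ℂ, ∀ z, jacobiTheta1 z τ = c * σ z := by
  have hd : Differentiable ℂ (fun z => jacobiTheta1 z τ) := by
    have : (fun z => jacobiTheta1 z τ) = fun z => -I * Complex.exp (Real.pi * I * τ / 4 + Real.pi * I * z) *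
      jacobiTheta₂ (z + 1 / 2 + τ / 2) τ := funext fun z => theta1_eq z τ
    rw [this]
    have h2 : Differentiable ℂ (fun z => jacobiTheta₂ z τ) := fun z =>
      differentiableAt_jacobiTheta₂_fst z hτ
    have h3 : Differentiable ℂ (fun z => jacobiTheta₂ (z + 1 / 2 + τ / 2) τ) :=
      h2.comp (f := fun z => z + 1 / 2 + τ / 2) (by fun_prop)
    fun_prop
  have hp1 : ∀ z, jacobiTheta1 (z + 1) τ = -jacobiTheta1 z τ := by
    intro z
    rw [theta1_eq, theta1_eq, show z + 1 + 1 / 2 + τ / 2 = (z + 1 / 2 + τ / 2) + 1 by ring,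
      jacobiTheta₂_add_left, mul_add, ← add_assoc, Complex.exp_add, mul_one, Complex.exp_pi_mul_I]
    ring
  have hpt : ∀ z, jacobiTheta1 (z + τ) τ =
      -(Complex.exp (-(Real.pi * I * τ) - 2 * Real.pi * I * z)) * jacobiTheta1 z τ := by
    intro z
    rw [theta1_eq, theta1_eq, show z + τ + 1 / 2 + τ / 2 = (z + 1 / 2 + τ / 2) + τ by ring,
      jacobiTheta₂_add_left']
    have e : Complex.exp (Real.pi * I * τ / 4 + Real.pi * I * (z + τ)) *
      Complex.exp (-Real.pi * I * (τ + 2 * (z + 1 / 2 + τ / 2))) =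
      -(Complex.exp (-(Real.pi * I * τ) - 2 * Real.pi * I * z)) *
        Complex.exp (Real.pi * I * τ / 4 + Real.pi * I * z) := by
      rw [← neg_one_mul (Complex.exp (-(Real.pi * I * τ) - 2 * Real.pi * I * z)), ← exp_pi_I',
        ← Complex.exp_add, ← Complex.exp_add, ← Complex.exp_add]
      congr 1
      ring
    linear_combination (-I * jacobiTheta₂ (z + 1 / 2 + τ / 2) τ) * e
  have h0 : jacobiTheta1 0 τ = 0 := by
    rw [theta1_eq]
    have e1 : jacobiTheta₂ (0 + 1 / 2 + τ / 2) τ = -jacobiTheta₂ (0 + 1 / 2 + τ / 2) τ := by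
      conv_lhs => rw [show (0 : ℂ) + 1 / 2 + τ / 2 = -(0 + 1 / 2 + τ / 2) + 1 + τ by ring,
        jacobiTheta₂_add_left', jacobiTheta₂_add_left, jacobiTheta₂_neg_left]
      rw [show -(Real.pi : ℂ) * I * (τ + 2 * (-(0 + 1 / 2 + τ / 2) + 1)) = -(Real.pi * I) by ring, exp_pi_I']
      ring
    have : jacobiTheta₂ (0 + 1 / 2 + τ / 2) τ = 0 := by linear_combination e1 / 2
    rw [this, mul_zero]
  obtain ⟨A, hA⟩ := ext_lemma hτ hσ {0} (fun z => jacobiTheta1 z τ / σ z) 1 one_ne_zero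
    (fun z => by rw [hp1, hσ.per1, neg_div_neg_eq])
    (fun z => by
      rw [hpt, hσ.pert, one_mul]
      rw [mul_div_mul_left]
      simp [Complex.exp_ne_zero])
    (fun z hz => by
      have hz' : σ z ≠ 0 := by simpa using hz
      exact (hd z).div (hσ.diff z) hz')
    (fun a ha => by
      have : a = 0 := by simpa using ha
      subst this
      have t1 := hσ.slope 0
      have t2 := (hd.continuous.tendsto 0).mono_left (nhdsWithin_le_nhds (s := {0}ᶜ))
      have := t1.mul t2
      simp only [h0, mul_zero] at this
      refine this.congr fun z => ?_
      simp only [sub_zero]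
      ring)
  simp only [Finset.mem_singleton, forall_eq, sub_zero, norm_one, Real.log_one, zero_div,
    Complex.ofReal_zero, mul_zero, zero_mul, neg_zero, Complex.exp_zero, mul_one] at hA
  refine ⟨A, fun z => ?_⟩
  have c1 := (hd.continuous.tendsto z).mono_left (nhdsWithin_le_nhds (s := {z}ᶜ))
  have c2 : Tendsto (fun w => A * σ w) (𝓝[≠] z) (𝓝 (A * σ z)) :=
    ((continuous_const.mul hσ.diff.continuous).tendsto z).mono_left nhdsWithin_le_nhds
  refine tendsto_nhds_unique (c1.congr' ?_) c2
  filter_upwards [hσ.ev_ne 0 z] with w hw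
  rw [sub_zero] at hw
  exact (div_eq_iff hw).mp (hA w hw)

noncomputable def hh (σ : ℂ → ℂ) (μ z : ℂ) : ℂ := σ (z - μ) / σ z

/-- The cross product of pair factors. -/
noncomputable def tF {ι : Type} (h : ℂ → ℂ) (x : ι → ℂ) (κ : ℂ) (A B : Finset ι) : ℂ :=
  ∏ i ∈ A, ∏ j ∈ B, (h (x i - x j) * h (x j - x i - κ))

theorem IsSig.hh_diff {τ : ℂ} {σ : ℂ → ℂ} (hσ : IsSig τ σ) (μ z : ℂ) (hz : σ z ≠ 0) :
    DifferentiableAt ℂ (hh σ μ) z := by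
  have h1 : Differentiable ℂ (fun z => σ (z - μ)) := hσ.diff.comp (by fun_prop)
  exact (h1 z).div (hσ.diff z) hz

theorem IsSig.hh_per1 {τ : ℂ} {σ : ℂ → ℂ} (hσ : IsSig τ σ) (μ z : ℂ) :
    hh σ μ (z - 1) = hh σ μ z := by
  have a := hσ.per1 (z - 1 - μ)
  have b := hσ.per1 (z - 1)
  rw [show z - 1 - μ + 1 = z - μ by ring] at a
  rw [show z - 1 + 1 = z by ring] at b
  unfold hh
  rw [a, b, neg_div_neg_eq]

theorem IsSig.hh_pert {τ : ℂ} {σ : ℂ → ℂ} (hσ : IsSig τ σ) (μ z : ℂ) :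
    hh σ μ (z - τ) = Complex.exp (-(2 * Real.pi * I * μ)) * hh σ μ z := by
  have a := hσ.pert (z - τ - μ)
  have b := hσ.pert (z - τ)
  rw [show z - τ - μ + τ = z - μ by ring] at a
  rw [show z - τ + τ = z by ring] at b
  unfold hh
  rw [a, b, show -(Real.pi * I * τ) - 2 * Real.pi * I * (z - τ - μ) =
    (-(Real.pi * I * τ) - 2 * Real.pi * I * (z - τ)) + 2 * Real.pi * I * μ by ring, Complex.exp_add,
    Complex.exp_neg (2 * Real.pi * I * μ)]
  have e1 := Complex.exp_ne_zero (2 * Real.pi * I * μ)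
  have e2 := Complex.exp_ne_zero (-(Real.pi * I * τ) - 2 * Real.pi * I * (z - τ))
  by_cases h : σ (z - τ) = 0
  · simp [h]
  · field_simp

theorem tF_diff {ι : Type} {τ : ℂ} {σ : ℂ → ℂ} (hσ : IsSig τ σ) (μ : ℂ) (x : ι → ℂ) (κ : ℂ)
    (A B : Finset ι) (h : ∀ i ∈ A, ∀ j ∈ B, σ (x j - x i - κ) ≠ 0) :
    DifferentiableAt ℂ (fun κ => tF (hh σ μ) x κ A B) κ := by
  unfold tF
  refine DifferentiableAt.fun_finsetProd fun i hi => DifferentiableAt.fun_finsetProd fun j hj => ?_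
  refine DifferentiableAt.const_mul ?_ _
  exact (hσ.hh_diff μ _ (h i hi j hj)).comp κ (f := fun κ => x j - x i - κ) (by fun_prop)

theorem tF_cont {ι : Type} [Fintype ι] {τ : ℂ} {σ : ℂ → ℂ} (hσ : IsSig τ σ) (μ : ℂ) (x : ι → ℂ) (κ : ℂ)
    (A B : Finset ι) (h : ∀ i ∈ A, ∀ j ∈ B, σ (x i - x j) ≠ 0 ∧ σ (x j - x i - κ) ≠ 0) :
    ContinuousAt (fun x : ι → ℂ => tF (hh σ μ) x κ A B) x := by
  unfold tF
  refine tendsto_finsetProd _ fun i hi => tendsto_finsetProd _ fun j hj => ?_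
  refine Tendsto.mul ?_ ?_
  · exact ((hσ.hh_diff μ _ (h i hi j hj).1).continuousAt).comp_of_eq
      (f := fun x : ι → ℂ => x i - x j) (by fun_prop) rfl
  · exact ((hσ.hh_diff μ _ (h i hi j hj).2).continuousAt).comp_of_eq
      (f := fun x : ι → ℂ => x j - x i - κ) (by fun_prop) rfl

theorem tF_per1 {ι : Type} {τ : ℂ} {σ : ℂ → ℂ} (hσ : IsSig τ σ) (μ : ℂ) (x : ι → ℂ) (κ : ℂ)
    (A B : Finset ι) : tF (hh σ μ) x (κ + 1) A B = tF (hh σ μ) x κ A B := by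
  unfold tF
  refine Finset.prod_congr rfl fun i _ => Finset.prod_congr rfl fun j _ => ?_
  rw [← sub_sub, hσ.hh_per1]

theorem tF_pert {ι : Type} {τ : ℂ} {σ : ℂ → ℂ} (hσ : IsSig τ σ) (μ : ℂ) (x : ι → ℂ) (κ : ℂ)
    (A B : Finset ι) : tF (hh σ μ) x (κ + τ) A B =
      Complex.exp (-(2 * Real.pi * I * μ)) ^ (A.card * B.card) * tF (hh σ μ) x κ A B := by
  unfold tF
  have : ∀ i j, hh σ μ (x i - x j) * hh σ μ (x j - x i - (κ + τ)) =
      Complex.exp (-(2 * Real.pi * I * μ)) * (hh σ μ (x i - x j) * hh σ μ (x j - x i - κ)) := by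
    intro i j
    rw [← sub_sub, hσ.hh_pert]; ring
  simp only [this, Finset.prod_mul_distrib, Finset.prod_const, ← pow_mul]
  rw [mul_comm B.card]

theorem tF_one {ι : Type} {τ : ℂ} {σ : ℂ → ℂ} (hσ : IsSig τ σ) (μ : ℂ) (x : ι → ℂ)
    (A B : Finset ι) (h : ∀ i ∈ A, ∀ j ∈ B, σ (x i - x j) ≠ 0 ∧ σ (x i - x j - μ) ≠ 0) :
    tF (hh σ μ) x (-μ) A B = 1 := by
  unfold tF
  refine Finset.prod_eq_one fun i hi => Finset.prod_eq_one fun j hj => ?_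
  obtain ⟨h1, h2⟩ := h i hi j hj
  unfold hh
  rw [show x j - x i - -μ - μ = -(x i - x j) by ring, show x j - x i - -μ = -(x i - x j - μ) by ring,
    hσ.odd, hσ.odd]
  field_simp

/-- The cofactor of a singular pair. -/
noncomputable def tR {ι : Type} (h : ℂ → ℂ) (x : ι → ℂ) (i0 j0 : ι) (κ : ℂ) (A B : Finset ι) : ℂ :=
  (∏ j ∈ B, (h (x i0 - x j) * h (x j - x i0 - κ))) *
    (∏ i ∈ A, (h (x i - x j0) * h (x j0 - x i - κ))) * tF h x κ A B

theorem tF_insert {ι : Type} [DecidableEq ι] (h : ℂ → ℂ) (x : ι → ℂ) (i0 j0 : ι) (κ : ℂ)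
    (A B : Finset ι) (hi : i0 ∉ A) (hj : j0 ∉ B) :
    tF h x κ (insert i0 A) (insert j0 B) =
      h (x i0 - x j0) * h (x j0 - x i0 - κ) * tR h x i0 j0 κ A B := by
  unfold tR tF
  rw [Finset.prod_insert hi, Finset.prod_insert hj]
  simp only [Finset.prod_insert hj]
  rw [Finset.prod_mul_distrib (s := A)]
  ring

theorem tR_diff {ι : Type} {τ : ℂ} {σ : ℂ → ℂ} (hσ : IsSig τ σ) (μ : ℂ) (x : ι → ℂ) (i0 j0 : ι) (κ : ℂ)
    (A B : Finset ι) (h : ∀ i ∈ A, ∀ j ∈ B, σ (x j - x i - κ) ≠ 0)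
    (h1 : ∀ j ∈ B, σ (x j - x i0 - κ) ≠ 0) (h2 : ∀ i ∈ A, σ (x j0 - x i - κ) ≠ 0) :
    DifferentiableAt ℂ (fun κ => tR (hh σ μ) x i0 j0 κ A B) κ := by
  unfold tR
  refine DifferentiableAt.fun_mul (DifferentiableAt.fun_mul ?_ ?_) (tF_diff hσ μ x κ A B h)
  · refine DifferentiableAt.fun_finsetProd fun j hj => ?_
    refine DifferentiableAt.const_mul ?_ _
    exact (hσ.hh_diff μ _ (h1 j hj)).comp κ (f := fun κ => x j - x i0 - κ) (by fun_prop)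
  · refine DifferentiableAt.fun_finsetProd fun j hj => ?_
    refine DifferentiableAt.const_mul ?_ _
    exact (hσ.hh_diff μ _ (h2 j hj)).comp κ (f := fun κ => x j0 - x j - κ) (by fun_prop)

theorem tR_at {ι : Type} [DecidableEq ι] (h : ℂ → ℂ) (x : ι → ℂ) (i0 j0 : ι)
    (A B : Finset ι) (hAB : Disjoint A B) :
    tR h x i0 j0 (x j0 - x i0) A B =
      (∏ k ∈ A ∪ B, (h (x i0 - x k) * h (x k - x j0))) * tF h x (x j0 - x i0) A B := by
  unfold tR
  rw [Finset.prod_union hAB, mul_comm (∏ k ∈ A, _)]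
  congr 2
  · refine Finset.prod_congr rfl fun j _ => ?_
    rw [show x j - x i0 - (x j0 - x i0) = x j - x j0 by ring]
  · refine Finset.prod_congr rfl fun j _ => ?_
    rw [show x j0 - x j - (x j0 - x i0) = x i0 - x j by ring, mul_comm]

theorem comb1 {ι : Type} [DecidableEq ι] (L : Finset ι) (i0 j0 : ι) (hi : i0 ∈ L)
    (p : ℕ) (f : Finset ι → ℂ) :
    ∑ P ∈ (L.powersetCard (p + 1)).filter (fun P => i0 ∈ P ∧ j0 ∉ P), f P =
      ∑ P ∈ (((L.erase i0).erase j0).powersetCard p).filter (fun _ => i0 ≠ j0), f (insert i0 P) := by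
  refine Finset.sum_nbij' (fun P => P.erase i0) (fun P => insert i0 P) ?_ ?_ ?_ ?_ ?_
  · intro P hP
    simp only [Finset.mem_filter, Finset.mem_powersetCard] at hP ⊢
    obtain ⟨⟨h1, h2⟩, h3, h4⟩ := hP
    refine ⟨⟨?_, ?_⟩, ?_⟩
    · intro k hk
      have := h1 (Finset.mem_of_mem_erase hk)
      simp only [Finset.mem_erase] at hk ⊢
      exact ⟨fun h => h4 (h ▸ hk.2), hk.1, this⟩
    · rw [Finset.card_erase_of_mem h3, h2]; rfl
    · rintro rfl; exact h4 h3
  · intro P hP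
    simp only [Finset.mem_filter, Finset.mem_powersetCard] at hP ⊢
    obtain ⟨⟨h1, h2⟩, h3⟩ := hP
    have hn : i0 ∉ P := fun h => by simpa using h1 h
    have hn2 : j0 ∉ P := fun h => by simpa using h1 h
    refine ⟨⟨?_, ?_⟩, ?_, ?_⟩
    · intro k hk
      rcases Finset.mem_insert.mp hk with rfl | hk
      · exact hi
      · exact Finset.mem_of_mem_erase (Finset.mem_of_mem_erase (h1 hk))
    · rw [Finset.card_insert_of_notMem hn, h2]
    · simp
    · simp [hn2, h3.symm]
  · intro P hP
    simp only [Finset.mem_filter] at hP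
    exact Finset.insert_erase hP.2.1
  · intro P hP
    simp only [Finset.mem_filter, Finset.mem_powersetCard] at hP
    exact Finset.erase_insert fun h => by simpa using hP.1.1 h
  · intro P hP
    simp only [Finset.mem_filter] at hP
    rw [Finset.insert_erase hP.2.1]

structure Gen {ι : Type} (σ : ℂ → ℂ) (μ : ℂ) (x : ι → ℂ) (L : Finset ι) : Prop where
  a : ∀ i ∈ L, ∀ j ∈ L, i ≠ j → σ (x i - x j) ≠ 0
  b : ∀ i ∈ L, ∀ j ∈ L, i ≠ j → σ (x i - x j - μ) ≠ 0
  c : ∀ i ∈ L, ∀ j ∈ L, ∀ k ∈ L, ∀ l ∈ L, i ≠ j → k ≠ l → (i ≠ k ∨ j ≠ l) →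
    σ (x i - x j - (x k - x l)) ≠ 0

theorem sing_lim {ι : Type} [DecidableEq ι] {τ : ℂ} {σ : ℂ → ℂ} (hσ : IsSig τ σ)
    (μ : ℂ) (x : ι → ℂ) (L : Finset ι) (hG : Gen σ μ x L) (p : ℕ) (i0 j0 : ι) (hi : i0 ∈ L)
    (hj : j0 ∈ L) (hij : i0 ≠ j0)
    (ih : ∑ P ∈ ((L.erase i0).erase j0).powersetCard p,
        tF (hh σ μ) x (x j0 - x i0) P (((L.erase i0).erase j0) \ P) =
      ∑ P ∈ ((L.erase i0).erase j0).powersetCard p,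
        tF (hh σ μ) x (x j0 - x i0) (((L.erase i0).erase j0) \ P) P) :
    Tendsto (fun κ => (κ - (x j0 - x i0)) * (∑ P ∈ L.powersetCard (p + 1), tF (hh σ μ) x κ P (L \ P) -
      ∑ P ∈ L.powersetCard (p + 1), tF (hh σ μ) x κ (L \ P) P)) (𝓝[≠] (x j0 - x i0)) (𝓝 0) := by
  set a := x j0 - x i0 with ha
  set L' := (L.erase i0).erase j0 with hL'
  have hreg : ∀ i ∈ L, ∀ j ∈ L, i ≠ j → ¬ (i = i0 ∧ j = j0) → σ (x j - x i - a) ≠ 0 := by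
    intro i hi' j hj' hne hn
    exact hG.c j hj' i hi' j0 hj i0 hi hne.symm hij.symm (by
      by_contra hcon
      push Not at hcon
      exact hn ⟨hcon.2, hcon.1⟩)
  have hL'L : L' ⊆ L := (Finset.erase_subset _ _).trans (Finset.erase_subset _ _)
  have hi' : i0 ∉ L' := by simp [hL']
  have hj' : j0 ∉ L' := by simp [hL']
  have s1 : ∀ P ⊆ L', L \ insert i0 P = insert j0 (L' \ P) := by
    intro P hP
    ext k
    have := @hP k
    simp only [hL', Finset.mem_sdiff, Finset.mem_insert, Finset.mem_erase] at this ⊢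
    by_cases h1 : k = i0 <;> by_cases h2 : k = j0 <;> simp_all
  have s2 : ∀ P ⊆ L', L \ insert j0 P = insert i0 (L' \ P) := by
    intro P hP
    ext k
    have := @hP k
    simp only [hL', Finset.mem_sdiff, Finset.mem_insert, Finset.mem_erase] at this ⊢
    by_cases h1 : k = i0 <;> by_cases h2 : k = j0 <;> simp_all
  let RF : ℂ → ℂ := fun κ => ∑ P ∈ L'.powersetCard p, tR (hh σ μ) x i0 j0 κ P (L' \ P)
  let RG : ℂ → ℂ := fun κ => ∑ P ∈ L'.powersetCard p, tR (hh σ μ) x i0 j0 κ (L' \ P) P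
  let NF : ℂ → ℂ := fun κ => ∑ P ∈ (L.powersetCard (p + 1)).filter (fun P => ¬ (i0 ∈ P ∧ j0 ∉ P)),
    tF (hh σ μ) x κ P (L \ P)
  let NG : ℂ → ℂ := fun κ => ∑ P ∈ (L.powersetCard (p + 1)).filter (fun P => ¬ (j0 ∈ P ∧ i0 ∉ P)),
    tF (hh σ μ) x κ (L \ P) P
  have eF : ∀ κ, ∑ P ∈ L.powersetCard (p + 1), tF (hh σ μ) x κ P (L \ P) =
      hh σ μ (x i0 - x j0) * hh σ μ (a - κ) * RF κ + NF κ := by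
    intro κ
    rw [← Finset.sum_filter_add_sum_filter_not _ (fun P => i0 ∈ P ∧ j0 ∉ P), comb1 L i0 j0 hi,
      Finset.filter_true_of_mem (fun _ _ => hij), Finset.mul_sum]
    congr 1
    refine Finset.sum_congr rfl fun P hP => ?_
    have hP' := (Finset.mem_powersetCard.mp hP).1
    rw [s1 P hP', tF_insert _ _ _ _ _ _ _ (fun h => hi' (hP' h)) (by simp [hj'])]
  have eG : ∀ κ, ∑ P ∈ L.powersetCard (p + 1), tF (hh σ μ) x κ (L \ P) P =
      hh σ μ (x i0 - x j0) * hh σ μ (a - κ) * RG κ + NG κ := by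
    intro κ
    rw [← Finset.sum_filter_add_sum_filter_not _ (fun P => j0 ∈ P ∧ i0 ∉ P), comb1 L j0 i0 hj,
      Finset.filter_true_of_mem (fun _ _ => hij.symm), Finset.mul_sum, Finset.erase_right_comm]
    congr 1
    refine Finset.sum_congr rfl fun P hP => ?_
    have hP' := (Finset.mem_powersetCard.mp hP).1
    rw [s2 P hP', tF_insert _ _ _ _ _ _ _ (by simp [hi']) (fun h => hj' (hP' h))]
  have cF : ContinuousAt NF a := by
    refine tendsto_finsetSum _ fun P hP => ?_
    simp only [Finset.mem_filter, Finset.mem_powersetCard] at hP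
    refine (tF_diff hσ μ x a P (L \ P) fun i hiP j hjQ => ?_).continuousAt
    simp only [Finset.mem_sdiff] at hjQ
    refine hreg i (hP.1.1 hiP) j hjQ.1 (fun h => hjQ.2 (h ▸ hiP)) ?_
    rintro ⟨h1, h2⟩
    exact hP.2 ⟨h1 ▸ hiP, h2 ▸ hjQ.2⟩
  have cG : ContinuousAt NG a := by
    refine tendsto_finsetSum _ fun P hP => ?_
    simp only [Finset.mem_filter, Finset.mem_powersetCard] at hP
    refine (tF_diff hσ μ x a (L \ P) P fun i hiP j hjQ => ?_).continuousAt
    simp only [Finset.mem_sdiff] at hiP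
    refine hreg i hiP.1 j (hP.1.1 hjQ) (fun h => hiP.2 (h ▸ hjQ)) ?_
    rintro ⟨h1, h2⟩
    exact hP.2 ⟨h2 ▸ hjQ, h1 ▸ hiP.2⟩
  have cR : ∀ A ⊆ L', ∀ B ⊆ L', Disjoint A B → ContinuousAt (fun κ => tR (hh σ μ) x i0 j0 κ A B) a := by
    intro A hA B hB hAB
    refine (tR_diff hσ μ x i0 j0 a A B ?_ ?_ ?_).continuousAt
    · intro i hiA j hjB
      refine hreg i (hL'L (hA hiA)) j (hL'L (hB hjB)) (fun h => Finset.disjoint_left.mp hAB hiA (h ▸ hjB)) ?_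
      rintro ⟨h1, -⟩
      exact hi' (hA (h1 ▸ hiA))
    · intro j hjB
      refine hreg i0 hi j (hL'L (hB hjB)) (fun h => hi' (hB (h ▸ hjB))) ?_
      rintro ⟨-, h1⟩
      exact hj' (hB (h1 ▸ hjB))
    · intro i hiA
      refine hreg i (hL'L (hA hiA)) j0 hj (fun h => hj' (hA (h ▸ hiA))) ?_
      rintro ⟨h1, -⟩
      exact hi' (hA (h1 ▸ hiA))
  have cRF : ContinuousAt RF a := by
    refine tendsto_finsetSum _ fun P hP => ?_
    exact cR P (Finset.mem_powersetCard.mp hP).1 _ Finset.sdiff_subset Finset.disjoint_sdiff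
  have cRG : ContinuousAt RG a := by
    refine tendsto_finsetSum _ fun P hP => ?_
    exact cR _ Finset.sdiff_subset P (Finset.mem_powersetCard.mp hP).1 Finset.sdiff_disjoint
  have hR : RF a = RG a := by
    have e1 : RF a = (∏ k ∈ L', (hh σ μ (x i0 - x k) * hh σ μ (x k - x j0))) *
        ∑ P ∈ L'.powersetCard p, tF (hh σ μ) x a P (L' \ P) := by
      rw [Finset.mul_sum]
      refine Finset.sum_congr rfl fun P hP => ?_
      rw [ha, tR_at _ _ _ _ _ _ Finset.disjoint_sdiff,
        Finset.union_sdiff_of_subset (Finset.mem_powersetCard.mp hP).1]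
    have e2 : RG a = (∏ k ∈ L', (hh σ μ (x i0 - x k) * hh σ μ (x k - x j0))) *
        ∑ P ∈ L'.powersetCard p, tF (hh σ μ) x a (L' \ P) P := by
      rw [Finset.mul_sum]
      refine Finset.sum_congr rfl fun P hP => ?_
      rw [ha, tR_at _ _ _ _ _ _ Finset.sdiff_disjoint,
        Finset.sdiff_union_of_subset (Finset.mem_powersetCard.mp hP).1]
    rw [e1, e2, ih]
  have t1 := hσ.slope a
  have c3 : ContinuousAt (fun κ => hh σ μ (x i0 - x j0) * -σ (a - κ - μ) * (RF κ - RG κ)) a := by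
    have : Continuous (fun κ => σ (a - κ - μ)) := hσ.diff.continuous.comp (by fun_prop)
    have := this.continuousAt (x := a)
    exact (continuousAt_const.mul this.neg).mul (cRF.sub cRG)
  have c4 : ContinuousAt (fun κ => (κ - a) * (NF κ - NG κ)) a :=
    (continuousAt_id.sub continuousAt_const).mul (cF.sub cG)
  have t3 := c3.tendsto.mono_left (nhdsWithin_le_nhds (s := {a}ᶜ))
  have t4 := c4.tendsto.mono_left (nhdsWithin_le_nhds (s := {a}ᶜ))
  have t := (t1.mul t3).add t4
  simp only [hR, sub_self, mul_zero, zero_mul, add_zero] at t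
  refine t.congr fun κ => ?_
  rw [eF, eG]
  have : hh σ μ (a - κ) = -σ (a - κ - μ) / σ (κ - a) := by
    unfold hh
    rw [show a - κ = -(κ - a) by ring, hσ.odd, div_neg, neg_div]
  rw [this]
  ring

theorem main_gen {ι : Type} [DecidableEq ι] {τ : ℂ} (hτ : 0 < τ.im) {σ : ℂ → ℂ} (hσ : IsSig τ σ)
    (μ : ℂ) (x : ι → ℂ) (L : Finset ι) : Gen σ μ x L → ∀ κ : ℂ,
    (∀ i ∈ L, ∀ j ∈ L, i ≠ j → σ (x j - x i - κ) ≠ 0) → ∀ p : ℕ,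
    ∑ P ∈ L.powersetCard p, tF (hh σ μ) x κ P (L \ P) =
      ∑ P ∈ L.powersetCard p, tF (hh σ μ) x κ (L \ P) P := by
  induction L using Finset.strongInduction with
  | H L ihL =>
    intro hG κ hκ p
    rcases p with _ | p
    · simp [tF]
    let S : Finset ℂ := L.offDiag.image (fun ij => x ij.2 - x ij.1)
    have hS : ∀ z, (∀ a ∈ S, σ (z - a) ≠ 0) ↔ ∀ i ∈ L, ∀ j ∈ L, i ≠ j → σ (x j - x i - z) ≠ 0 := by
      intro z
      have e : ∀ i j, σ (x j - x i - z) = - σ (z - (x j - x i)) := fun i j => by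
        rw [← hσ.odd]; ring_nf
      constructor
      · intro h i hi j hj hij
        rw [e]
        exact neg_ne_zero.mpr (h _ (Finset.mem_image.mpr ⟨(i, j), by simp [hi, hj, hij], rfl⟩))
      · intro h a ha
        obtain ⟨⟨i, j⟩, hm, rfl⟩ := Finset.mem_image.mp ha
        simp only [Finset.mem_offDiag] at hm
        have := h i hm.1 j hm.2.1 hm.2.2
        rw [e] at this
        exact neg_ne_zero.mp this
    let φ : ℂ → ℂ := fun κ => ∑ P ∈ L.powersetCard (p + 1), tF (hh σ μ) x κ P (L \ P) -
      ∑ P ∈ L.powersetCard (p + 1), tF (hh σ μ) x κ (L \ P) P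
    obtain ⟨A, hA⟩ := ext_lemma hτ hσ S φ
      (Complex.exp (-(2 * Real.pi * I * μ)) ^ ((p + 1) * (L.card - (p + 1))))
      (pow_ne_zero _ (Complex.exp_ne_zero _))
      (fun z => by simp only [φ, tF_per1 hσ])
      (fun z => by
        simp only [φ, tF_pert hσ, mul_sub, Finset.mul_sum]
        congr 1
        · refine Finset.sum_congr rfl fun P hP => ?_
          rw [Finset.mem_powersetCard] at hP
          rw [Finset.card_sdiff_of_subset hP.1, hP.2]
        · refine Finset.sum_congr rfl fun P hP => ?_
          rw [Finset.mem_powersetCard] at hP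
          rw [Finset.card_sdiff_of_subset hP.1, hP.2, mul_comm (p + 1)])
      (fun z hz => by
        rw [hS] at hz
        refine DifferentiableAt.fun_sub ?_ ?_
        · refine DifferentiableAt.fun_sum fun P hP => tF_diff hσ μ x z _ _ fun i hi j hj => ?_
          rw [Finset.mem_powersetCard] at hP
          rw [Finset.mem_sdiff] at hj
          exact hz i (hP.1 hi) j hj.1 fun h => hj.2 (h ▸ hi)
        · refine DifferentiableAt.fun_sum fun P hP => tF_diff hσ μ x z _ _ fun i hi j hj => ?_
          rw [Finset.mem_powersetCard] at hP
          rw [Finset.mem_sdiff] at hi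
          exact hz i hi.1 j (hP.1 hj) fun h => hi.2 (h ▸ hj))
      (fun a ha => by
        obtain ⟨⟨i, j⟩, hm, rfl⟩ := Finset.mem_image.mp ha
        simp only [Finset.mem_offDiag] at hm
        obtain ⟨hi, hj, hij⟩ := hm
        have hsub : (L.erase i).erase j ⊆ L := (Finset.erase_subset _ _).trans (Finset.erase_subset _ _)
        refine sing_lim hσ μ x L hG p i j hi hj hij ?_
        refine ihL _ ?_ ?_ _ ?_ p
        · exact Finset.ssubset_of_subset_of_ssubset (Finset.erase_subset _ _) (Finset.erase_ssubset hi)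
        · exact ⟨fun i hi j hj => hG.a i (hsub hi) j (hsub hj), fun i hi j hj => hG.b i (hsub hi) j (hsub hj),
            fun i hi j hj k hk l hl => hG.c i (hsub hi) j (hsub hj) k (hsub hk) l (hsub hl)⟩
        · intro k hk l hl hkl
          refine hG.c l (hsub hl) k (hsub hk) j hj i hi hkl.symm hij.symm (Or.inl ?_)
          rintro rfl
          simp at hl)
    have h0 : φ (-μ) = 0 := by
      have e1 : ∀ P ∈ L.powersetCard (p + 1), tF (hh σ μ) x (-μ) P (L \ P) = 1 := by
        intro P hP
        rw [Finset.mem_powersetCard] at hP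
        refine tF_one hσ μ x _ _ fun i hi j hj => ?_
        rw [Finset.mem_sdiff] at hj
        have hne : i ≠ j := fun h => hj.2 (h ▸ hi)
        exact ⟨hG.a i (hP.1 hi) j hj.1 hne, hG.b i (hP.1 hi) j hj.1 hne⟩
      have e2 : ∀ P ∈ L.powersetCard (p + 1), tF (hh σ μ) x (-μ) (L \ P) P = 1 := by
        intro P hP
        rw [Finset.mem_powersetCard] at hP
        refine tF_one hσ μ x _ _ fun i hi j hj => ?_
        rw [Finset.mem_sdiff] at hi
        have hne : i ≠ j := fun h => hi.2 (h ▸ hj)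
        exact ⟨hG.a i hi.1 j (hP.1 hj) hne, hG.b i hi.1 j (hP.1 hj) hne⟩
      simp only [φ]
      rw [Finset.sum_congr rfl e1, Finset.sum_congr rfl e2, sub_self]
    have hA0 : A = 0 := by
      have := hA (-μ) ((hS _).mpr fun i hi j hj hij => by
        have := hG.b i hi j hj hij
        rw [show x j - x i - -μ = -(x i - x j - μ) by ring, hσ.odd]
        exact neg_ne_zero.mpr this)
      rw [h0] at this
      exact (mul_eq_zero.mp this.symm).resolve_right (Complex.exp_ne_zero _)
    have := hA κ ((hS _).mpr hκ)
    rw [hA0, zero_mul] at this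
    exact sub_eq_zero.mp this

theorem dense_ne {ι : Type} [Fintype ι] {τ : ℂ} {σ : ℂ → ℂ} (hσ : IsSig τ σ)
    (ℓ : (ι → ℂ) → ℂ) (v : ι → ℂ) (d : ℂ) (hd : d ≠ 0) (hl : ∀ y t, ℓ (y + fun i => t * v i) = ℓ y + t * d) :
    Dense {y | σ (ℓ y) ≠ 0} := by
  intro y
  have hcont : Continuous (fun t : ℂ => (y + fun i => t * v i : ι → ℂ)) := by fun_prop
  have ht : Tendsto (fun t : ℂ => (y + fun i => t * v i : ι → ℂ)) (𝓝[≠] 0) (𝓝 y) := by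
    have := (hcont.tendsto 0).mono_left (nhdsWithin_le_nhds (s := {0}ᶜ))
    convert this using 2
    funext i; simp
  refine mem_closure_of_tendsto ht ?_
  have h2 : Tendsto (fun t : ℂ => ℓ y + t * d) (𝓝[≠] 0) (𝓝[≠] (ℓ y)) := by
    refine tendsto_nhdsWithin_of_tendsto_nhds_of_eventually_within _ ?_ ?_
    · have hc : Continuous (fun t : ℂ => ℓ y + t * d) := by fun_prop
      have := (hc.tendsto 0).mono_left (nhdsWithin_le_nhds (s := {0}ᶜ))
      simpa using this
    · filter_upwards [self_mem_nhdsWithin] with t ht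
      simpa [hd] using ht
  filter_upwards [h2.eventually (hσ.ev_ne 0 (ℓ y))] with t ht
  simpa [hl] using ht

theorem dense_gen {ι : Type} [Fintype ι] [DecidableEq ι] {τ : ℂ} {σ : ℂ → ℂ} (hσ : IsSig τ σ) (μ : ℂ) :
    Dense {y : ι → ℂ | Gen σ μ y Finset.univ} := by
  have hop : ∀ ℓ : (ι → ℂ) → ℂ, Continuous ℓ → IsOpen {y | σ (ℓ y) ≠ 0} := fun ℓ hℓ =>
    isOpen_ne_fun (hσ.diff.continuous.comp hℓ) continuous_const
  have hI : {y : ι → ℂ | Gen σ μ y Finset.univ} =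
      (⋂ q : {q : ι × ι // q.1 ≠ q.2}, {y : ι → ℂ | σ (y q.1.1 - y q.1.2) ≠ 0}) ∩
      ((⋂ q : {q : ι × ι // q.1 ≠ q.2}, {y : ι → ℂ | σ (y q.1.1 - y q.1.2 - μ) ≠ 0}) ∩
      (⋂ q : {q : ι × ι × ι × ι // q.1 ≠ q.2.1 ∧ q.2.2.1 ≠ q.2.2.2 ∧ (q.1 ≠ q.2.2.1 ∨ q.2.1 ≠ q.2.2.2)},
        {y : ι → ℂ | σ (y q.1.1 - y q.1.2.1 - (y q.1.2.2.1 - y q.1.2.2.2)) ≠ 0})) := by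
    ext y
    simp only [Set.mem_inter_iff, Set.mem_iInter, Set.mem_ofPred_eq]
    constructor
    · intro h
      exact ⟨fun q => h.a _ (Finset.mem_univ _) _ (Finset.mem_univ _) q.2,
        fun q => h.b _ (Finset.mem_univ _) _ (Finset.mem_univ _) q.2,
        fun q => h.c _ (Finset.mem_univ _) _ (Finset.mem_univ _) _ (Finset.mem_univ _) _ (Finset.mem_univ _)
          q.2.1 q.2.2.1 q.2.2.2⟩
    · rintro ⟨h1, h2, h3⟩
      exact ⟨fun i _ j _ hij => h1 ⟨(i, j), hij⟩, fun i _ j _ hij => h2 ⟨(i, j), hij⟩,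
        fun i _ j _ k _ l _ a b c => h3 ⟨(i, j, k, l), a, b, c⟩⟩
  rw [hI]
  have o1 : ∀ q : {q : ι × ι // q.1 ≠ q.2}, IsOpen {y : ι → ℂ | σ (y q.1.1 - y q.1.2) ≠ 0} :=
    fun q => hop (fun y => y q.1.1 - y q.1.2) (by fun_prop)
  have o2 : ∀ q : {q : ι × ι // q.1 ≠ q.2}, IsOpen {y : ι → ℂ | σ (y q.1.1 - y q.1.2 - μ) ≠ 0} :=
    fun q => hop (fun y => y q.1.1 - y q.1.2 - μ) (by fun_prop)
  have o3 : ∀ q : {q : ι × ι × ι × ι // q.1 ≠ q.2.1 ∧ q.2.2.1 ≠ q.2.2.2 ∧ (q.1 ≠ q.2.2.1 ∨ q.2.1 ≠ q.2.2.2)},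
      IsOpen {y : ι → ℂ | σ (y q.1.1 - y q.1.2.1 - (y q.1.2.2.1 - y q.1.2.2.2)) ≠ 0} :=
    fun q => hop (fun y => y q.1.1 - y q.1.2.1 - (y q.1.2.2.1 - y q.1.2.2.2)) (by fun_prop)
  refine Dense.inter_of_isOpen_left ?_ (Dense.inter_of_isOpen_left ?_ ?_ ?_) ?_
  · refine dense_iInter_of_isOpen o1 fun q => ?_
    refine dense_ne hσ (fun y => y q.1.1 - y q.1.2) (fun i => if i = q.1.1 then 1 else 0) 1 one_ne_zero ?_
    intro y t
    simp [q.2.symm]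
    ring
  · refine dense_iInter_of_isOpen o2 fun q => ?_
    refine dense_ne hσ (fun y => y q.1.1 - y q.1.2 - μ) (fun i => if i = q.1.1 then 1 else 0) 1 one_ne_zero ?_
    intro y t
    simp [q.2.symm]
    ring
  · refine dense_iInter_of_isOpen o3 ?_
    rintro ⟨⟨i, j, k, l⟩, hij, hkl, h⟩
    simp only at hij hkl h ⊢
    by_cases hik : i = k
    · have hjl : j ≠ l := h.resolve_left (fun hh => hh hik)
      subst hik
      refine dense_ne hσ (fun y => y i - y j - (y i - y l)) (fun m => if m = j then 1 else 0) (-1) (by simp) ?_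
      intro y t
      simp [hij, hjl.symm]
      ring
    · refine dense_ne hσ (fun y => y i - y j - (y k - y l)) (fun m => if m = i then 1 else 0)
        (1 + if l = i then 1 else 0) ?_ ?_
      · split_ifs <;> norm_num
      intro y t
      simp only [Pi.add_apply, if_neg hij.symm, if_neg (Ne.symm hik), if_true]
      split_ifs <;> ring
  · exact isOpen_iInter_of_finite o2
  · exact isOpen_iInter_of_finite o1

theorem main_all {ι : Type} [Fintype ι] [DecidableEq ι] {τ : ℂ} (hτ : 0 < τ.im) {σ : ℂ → ℂ}
    (hσ : IsSig τ σ) (μ κ : ℂ) (x : ι → ℂ) (L : Finset ι)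
    (h1 : ∀ i j, i ≠ j → σ (x i - x j) ≠ 0)
    (h2 : ∀ i j, i ≠ j → σ (x j - x i - κ) ≠ 0) (p : ℕ) :
    ∑ P ∈ L.powersetCard p, tF (hh σ μ) x κ P (L \ P) =
      ∑ P ∈ L.powersetCard p, tF (hh σ μ) x κ (L \ P) P := by
  have cF : ContinuousAt (fun x : ι → ℂ => ∑ P ∈ L.powersetCard p, tF (hh σ μ) x κ P (L \ P)) x := by
    refine tendsto_finsetSum _ fun P hP => tF_cont hσ μ x κ _ _ fun i hi j hj => ?_
    rw [Finset.mem_sdiff] at hj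
    have hne : i ≠ j := fun h => hj.2 (h ▸ hi)
    exact ⟨h1 i j hne, h2 i j hne⟩
  have cG : ContinuousAt (fun x : ι → ℂ => ∑ P ∈ L.powersetCard p, tF (hh σ μ) x κ (L \ P) P) x := by
    refine tendsto_finsetSum _ fun P hP => tF_cont hσ μ x κ _ _ fun i hi j hj => ?_
    rw [Finset.mem_sdiff] at hi
    have hne : i ≠ j := fun h => hi.2 (h ▸ hj)
    exact ⟨h1 i j hne, h2 i j hne⟩
  by_contra hne
  have hev := (cF.sub cG).eventually_ne (sub_ne_zero.mpr hne)
  have hev2 : ∀ᶠ y in 𝓝 x, ∀ i j, i ≠ j → σ (y j - y i - κ) ≠ 0 := by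
    simp only [Filter.eventually_all]
    intro i j hij
    have : Continuous (fun y : ι → ℂ => σ (y j - y i - κ)) := hσ.diff.continuous.comp (by fun_prop)
    exact this.continuousAt.eventually_ne (h2 i j hij)
  have hfr : ∃ᶠ y in 𝓝 x, Gen σ μ y Finset.univ := mem_closure_iff_frequently.mp (dense_gen hσ μ x)
  obtain ⟨y, hy, hy1, hy2⟩ := (hfr.and_eventually (hev.and hev2)).exists
  apply hy1
  simp only [Pi.sub_apply]
  rw [sub_eq_zero]
  exact main_gen hτ hσ μ y L ⟨fun i _ j _ => hy.a i (Finset.mem_univ _) j (Finset.mem_univ _),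
    fun i _ j _ => hy.b i (Finset.mem_univ _) j (Finset.mem_univ _),
    fun i _ j _ k _ l _ => hy.c i (Finset.mem_univ _) j (Finset.mem_univ _) k (Finset.mem_univ _) l (Finset.mem_univ _)⟩
    κ (fun i _ j _ => hy2 i j) p

theorem pr_ite {ι : Type} [Fintype ι] [DecidableEq ι] (A B : Finset ι) (g : ι → ι → ℂ) :
    ∏ i ∈ A, ∏ j ∈ B, g i j = ∏ i, ∏ j, if i ∈ A ∧ j ∈ B then g i j else 1 := by
  rw [← Finset.prod_subset (Finset.subset_univ A)]
  · refine Finset.prod_congr rfl fun i hi => ?_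
    rw [← Finset.prod_subset (Finset.subset_univ B)]
    · exact Finset.prod_congr rfl fun j hj => by simp [hi, hj]
    · intro j _ hj
      simp [hj]
  · intro i _ hi
    simp [hi]

noncomputable def bB {ι : Type} [Fintype ι] [DecidableEq ι] (h : ℂ → ℂ) (x : ι → ℂ) (κ : ℂ)
    (I J : Finset ι) : ℂ :=
  (∏ i ∈ I, ∏ j ∈ Iᶜ, h (x i - x j)) *
    ∏ i ∈ J, ∏ j ∈ Jᶜ, h ((x i + if i ∈ I then κ else 0) - (x j + if j ∈ I then κ else 0))

noncomputable def cm {ι : Type} [Fintype ι] [DecidableEq ι] (h : ℂ → ℂ) (x : ι → ℂ) (κ : ℂ)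
    (K M : Finset ι) : ℂ :=
  ∏ i, ∏ j, (if i ∈ K ∧ j ∉ K ∧ j ∉ M then h (x i - x j) * h (x i - x j + κ) else
    if (i ∈ K ∧ j ∈ M) ∨ (i ∈ M ∧ j ∉ K ∧ j ∉ M) then h (x i - x j) else 1)

theorem bB_eq {ι : Type} [Fintype ι] [DecidableEq ι] (h : ℂ → ℂ) (x : ι → ℂ) (κ : ℂ)
    (I J : Finset ι) :
    bB h x κ I J = cm h x κ (I ∩ J) (I \ J ∪ J \ I) * tF h x κ (I \ J) (J \ I) := by
  have e : tF h x κ (I \ J) (J \ I) = (∏ i ∈ I \ J, ∏ j ∈ J \ I, h (x i - x j)) *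
      ∏ i ∈ J \ I, ∏ j ∈ I \ J, h (x i - x j - κ) := by
    unfold tF
    simp only [Finset.prod_mul_distrib]
    congr 1
    exact Finset.prod_comm
  rw [e]
  unfold bB cm
  rw [pr_ite I Iᶜ, pr_ite J Jᶜ, pr_ite (I \ J) (J \ I), pr_ite (J \ I) (I \ J)]
  simp only [← Finset.prod_mul_distrib]
  refine Finset.prod_congr rfl fun i _ => Finset.prod_congr rfl fun j _ => ?_
  have e1 : x i + κ - x j = x i - x j + κ := by ring
  have e2 : x i - (x j + κ) = x i - x j - κ := by ring
  by_cases h1 : i ∈ I <;> by_cases h2 : i ∈ J <;> by_cases h3 : j ∈ I <;> by_cases h4 : j ∈ J <;>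
    simp [h1, h2, h3, h4, e1, e2]

theorem comb_main {ι : Type} [Fintype ι] [DecidableEq ι] (h : ℂ → ℂ) (x : ι → ℂ) (κ : ℂ)
    (hid : ∀ (M : Finset ι) (p : ℕ), ∑ P ∈ M.powersetCard p, tF h x κ P (M \ P) =
      ∑ P ∈ M.powersetCard p, tF h x κ (M \ P) P) (r s : ℕ) (F : Finset ι → Finset ι → ℂ) :
    ∑ I ∈ (Finset.univ : Finset ι).powersetCard r, ∑ J ∈ (Finset.univ : Finset ι).powersetCard s,
      bB h x κ I J * F (I ∩ J) (I \ J ∪ J \ I) =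
    ∑ I ∈ (Finset.univ : Finset ι).powersetCard r, ∑ J ∈ (Finset.univ : Finset ι).powersetCard s,
      bB h x κ J I * F (I ∩ J) (I \ J ∪ J \ I) := by
  rw [← Finset.sum_product', ← Finset.sum_product']
  rw [← Finset.sum_fiberwise _ (fun q : Finset ι × Finset ι => (q.1 ∩ q.2, q.1 \ q.2 ∪ q.2 \ q.1))]
  conv_rhs => rw [← Finset.sum_fiberwise _
    (fun q : Finset ι × Finset ι => (q.1 ∩ q.2, q.1 \ q.2 ∪ q.2 \ q.1))]
  refine Finset.sum_congr rfl ?_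
  rintro ⟨K, M⟩ -
  set T := ((Finset.univ : Finset ι).powersetCard r ×ˢ (Finset.univ : Finset ι).powersetCard s).filter
    (fun q : Finset ι × Finset ι => (q.1 ∩ q.2, q.1 \ q.2 ∪ q.2 \ q.1) = (K, M)) with hT
  have hmem : ∀ q : Finset ι × Finset ι, q ∈ T ↔
      (q.1.card = r ∧ q.2.card = s) ∧ q.1 ∩ q.2 = K ∧ q.1 \ q.2 ∪ q.2 \ q.1 = M := by
    intro q
    simp [hT]
  rcases T.eq_empty_or_nonempty with hE | ⟨⟨I0, J0⟩, h0⟩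
  · rw [hE]; simp
  rw [hmem] at h0
  obtain ⟨⟨hI0, hJ0⟩, hK0, hM0⟩ := h0
  dsimp only at hI0 hJ0 hK0 hM0
  have hKM : Disjoint K M := by
    rw [← hK0, ← hM0, Finset.disjoint_left]
    intro a; simp only [Finset.mem_inter, Finset.mem_union, Finset.mem_sdiff]; tauto
  have cI : ∀ I J : Finset ι, (I \ J).card + (I ∩ J).card = I.card := fun I J =>
    Finset.card_sdiff_add_card_inter I J
  have cM : ∀ I J : Finset ι, (I \ J ∪ J \ I).card = (I \ J).card + (J \ I).card := fun I J =>
    Finset.card_union_of_disjoint disjoint_sdiff_sdiff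
  have h01 := cI I0 J0
  have h02 := cI J0 I0
  have h03 := cM I0 J0
  rw [Finset.inter_comm J0 I0] at h02
  rw [hK0] at h01 h02
  rw [hM0] at h03
  have hMP : ∀ I J : Finset ι, I \ J ∪ J \ I = M → J \ I = M \ (I \ J) := by
    rintro I J rfl
    ext a; simp only [Finset.mem_union, Finset.mem_sdiff]; tauto
  have key : ∀ G : Finset ι → Finset ι → ℂ, ∑ q ∈ T, G (q.1 \ q.2) (q.2 \ q.1) =
      ∑ P ∈ M.powersetCard (r - K.card), G P (M \ P) := by
    intro G
    refine Finset.sum_nbij' (fun q => q.1 \ q.2) (fun P => (K ∪ P, K ∪ (M \ P))) ?_ ?_ ?_ ?_ ?_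
    · intro q hq
      rw [hmem] at hq
      obtain ⟨⟨h1, h2⟩, h3, h4⟩ := hq
      rw [Finset.mem_powersetCard]
      refine ⟨?_, ?_⟩
      · rw [← h4]; exact Finset.subset_union_left
      · have := cI q.1 q.2
        rw [h3] at this
        omega
    · intro P hP
      rw [Finset.mem_powersetCard] at hP
      rw [hmem]
      have d1 : Disjoint K P := hKM.mono_right hP.1
      have d2 : Disjoint K (M \ P) := hKM.mono_right Finset.sdiff_subset
      have hc := Finset.card_sdiff_of_subset hP.1
      have hc2 := Finset.card_le_card hP.1
      dsimp only
      refine ⟨⟨?_, ?_⟩, ?_, ?_⟩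
      · rw [Finset.card_union_of_disjoint d1]; omega
      · rw [Finset.card_union_of_disjoint d2]; omega
      · ext a
        simp only [Finset.mem_union, Finset.mem_sdiff, Finset.mem_inter]; tauto
      · ext a
        have := @hP.1 a
        have hda : a ∈ K → a ∉ M := fun hk => Finset.disjoint_left.mp hKM hk
        simp only [Finset.mem_union, Finset.mem_sdiff]; tauto
    · rintro ⟨I, J⟩ hq
      rw [hmem] at hq
      obtain ⟨-, h3, h4⟩ := hq
      dsimp only at h3 h4 ⊢
      rw [← hMP I J h4, ← h3]
      ext a <;> simp only [Finset.mem_union, Finset.mem_sdiff, Finset.mem_inter] <;> tauto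
    · intro P hP
      rw [Finset.mem_powersetCard] at hP
      ext a
      have := @hP.1 a
      have hda : a ∈ K → a ∉ M := fun hk => Finset.disjoint_left.mp hKM hk
      simp only [Finset.mem_union, Finset.mem_sdiff]; tauto
    · intro q hq
      rw [hmem] at hq
      rw [hMP _ _ hq.2.2]
  have l1 : ∑ q ∈ T, bB h x κ q.1 q.2 * F (q.1 ∩ q.2) (q.1 \ q.2 ∪ q.2 \ q.1) =
      ∑ q ∈ T, cm h x κ K M * F K M * tF h x κ (q.1 \ q.2) (q.2 \ q.1) := by
    refine Finset.sum_congr rfl fun q hq => ?_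
    rw [hmem] at hq
    rw [bB_eq, hq.2.1, hq.2.2]; ring
  have l2 : ∑ q ∈ T, bB h x κ q.2 q.1 * F (q.1 ∩ q.2) (q.1 \ q.2 ∪ q.2 \ q.1) =
      ∑ q ∈ T, cm h x κ K M * F K M * tF h x κ (q.2 \ q.1) (q.1 \ q.2) := by
    refine Finset.sum_congr rfl fun q hq => ?_
    rw [hmem] at hq
    rw [bB_eq, Finset.inter_comm q.2, Finset.union_comm (q.2 \ q.1), hq.2.1, hq.2.2]; ring
  rw [l1, l2, key (fun A B => cm h x κ K M * F K M * tF h x κ A B),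
    key (fun A B => cm h x κ K M * F K M * tF h x κ B A), ← Finset.mul_sum, ← Finset.mul_sum, hid]

theorem D_D {n : ℕ} (τ μ κ : ℂ) (r s : ℕ) (f : (Fin n → ℂ) → ℂ) (x : Fin n → ℂ) :
    ruijsenaarsD n r μ κ τ (ruijsenaarsD n s μ κ τ f) x =
      ∑ I ∈ (Finset.univ : Finset (Fin n)).powersetCard r,
        ∑ J ∈ (Finset.univ : Finset (Fin n)).powersetCard s,
        bB (fun z => jacobiTheta1 (z - μ) τ / jacobiTheta1 z τ) x κ I J *
          f (fun j => x j + (if j ∈ I ∩ J then κ else 0) +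
            if j ∈ I ∩ J ∪ (I \ J ∪ J \ I) then κ else 0) := by
  unfold ruijsenaarsD bB
  refine Finset.sum_congr rfl fun I _ => ?_
  rw [Finset.mul_sum]
  refine Finset.sum_congr rfl fun J _ => ?_
  rw [← mul_assoc]
  congr 2
  funext j
  by_cases h1 : j ∈ I <;> by_cases h2 : j ∈ J <;> simp [h1, h2]

/-- **Commutativity of the elliptic Ruijsenaars operators:** for `n ≥ 1`, `Im τ > 0`,
`r, s ∈ {1, …, n}`, any `f : ℂⁿ → ℂ` and any `x ∈ ℂⁿ` such that `x_i − x_j + c ∉ ℤ + τℤ`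
for all `i ≠ j` and `c ∈ {−κ, 0, κ}`, one has `(D_r (D_s f))(x) = (D_s (D_r f))(x)`. -/
theorem ruijsenaarsD_commute (n : ℕ) (hn : 1 ≤ n) (τ : ℂ) (hτ : 0 < τ.im) (μ κ : ℂ)
    (r s : ℕ) (hr1 : 1 ≤ r) (hrn : r ≤ n) (hs1 : 1 ≤ s) (hsn : s ≤ n)
    (f : (Fin n → ℂ) → ℂ) (x : Fin n → ℂ)
    (hx : ∀ i j : Fin n, i ≠ j → ∀ c ∈ ({-κ, 0, κ} : Set ℂ),
      x i - x j + c ∉ latticeZtau τ) :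
    ruijsenaarsD n r μ κ τ (ruijsenaarsD n s μ κ τ f) x =
      ruijsenaarsD n s μ κ τ (ruijsenaarsD n r μ κ τ f) x := by
  rw [D_D, D_D]
  have hid : ∀ (M : Finset (Fin n)) (p : ℕ), ∑ P ∈ M.powersetCard p,
      tF (fun z => jacobiTheta1 (z - μ) τ / jacobiTheta1 z τ) x κ P (M \ P) =
      ∑ P ∈ M.powersetCard p,
        tF (fun z => jacobiTheta1 (z - μ) τ / jacobiTheta1 z τ) x κ (M \ P) P := by
    intro M p
    have hσ := sg_isSig hτ
    obtain ⟨c, hc⟩ := theta1_sig hτ hσ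
    by_cases hc0 : c = 0
    · refine Finset.sum_congr rfl fun P _ => ?_
      unfold tF
      rw [Finset.prod_comm]
      simp [hc, hc0]
    · have he : (fun z => jacobiTheta1 (z - μ) τ / jacobiTheta1 z τ) = hh (sg τ) μ := by
        funext z
        rw [hc, hc, mul_div_mul_left _ _ hc0, hh]
      rw [he]
      refine main_all hτ hσ μ κ x M ?_ ?_ p
      · intro i j hij h0
        rw [hσ.zero] at h0
        exact hx i j hij 0 (by simp) (by simpa using h0)
      · intro i j hij h0
        rw [hσ.zero] at h0
        exact hx j i hij.symm (-κ) (by simp) (by simpa [sub_eq_add_neg] using h0)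
  rw [comb_main _ x κ hid r s (fun K M => f (fun j => x j + (if j ∈ K then κ else 0) +
            if j ∈ K ∪ M then κ else 0)), Finset.sum_comm]
  refine Finset.sum_congr rfl fun J _ => Finset.sum_congr rfl fun I _ => ?_
  rw [Finset.inter_comm I J, Finset.union_comm (I \ J)]
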